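/- Let k ∈ ℤ with k ≤ 0 and let f : ℍ → ℂ be smooth with Δ_k f = 0. Then the flipping operator is an involution on such functions: 𝔉_k(𝔉_k f) = f. -/

import Mathlib

open Complex

noncomputable section

/-- The upper half-plane, as a subset of `ℂ`. -/
def UH : Set ℂ := {z : ℂ | 0 < z.im}

/-- Partial derivative in the direction of the real axis, `∂f/∂u`. -/
noncomputable def du (f : ℂ → ℂ) (z : ℂ) : ℂ := fderiv ℝ f z 1

/-- Partial derivative in the direction of the imaginary axis, `∂f/∂v`. -/
noncomputable def dv (f : ℂ → ℂ) (z : ℂ) : ℂ := fderiv ℝ f z Complex.I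

/-- The Wirtinger derivative `∂_τ f = (1/2)(∂f/∂u − i ∂f/∂v)`. -/
noncomputable def dtau (f : ℂ → ℂ) (z : ℂ) : ℂ :=
  (1 / 2) * (du f z - Complex.I * dv f z)

/-- The Wirtinger derivative `∂_τ̄ f = (1/2)(∂f/∂u + i ∂f/∂v)`. -/
noncomputable def dtauBar (f : ℂ → ℂ) (z : ℂ) : ℂ :=
  (1 / 2) * (du f z + Complex.I * dv f z)

/-- The Maass raising operator `R_k f = 2i ∂_τ f + (k/v) f`. -/
noncomputable def Rop (k : ℤ) (f : ℂ → ℂ) (z : ℂ) : ℂ :=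
  2 * Complex.I * dtau f z + ((k : ℂ) / (z.im : ℂ)) * f z

/-- The Maass lowering operator `L_k f = −2i v² ∂_τ̄ f`. -/
noncomputable def Lop (_k : ℤ) (f : ℂ → ℂ) (z : ℂ) : ℂ :=
  -2 * Complex.I * (z.im : ℂ) ^ 2 * dtauBar f z

/-- The weight-`k` hyperbolic Laplacian
`Δ_k f = −v²(∂²f/∂u² + ∂²f/∂v²) + i k v (∂f/∂u + i ∂f/∂v)`. -/
noncomputable def Lap (k : ℤ) (f : ℂ → ℂ) (z : ℂ) : ℂ :=
  -(z.im : ℂ) ^ 2 * (du (du f) z + dv (dv f) z)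
    + Complex.I * (k : ℂ) * (z.im : ℂ) * (du f z + Complex.I * dv f z)

/-- Iterated raising operator `R_k^r = R_{k+2(r−1)} ∘ ⋯ ∘ R_{k+2} ∘ R_k`, `R_k^0 = id`. -/
noncomputable def Riter (k : ℤ) : ℕ → (ℂ → ℂ) → ℂ → ℂ
  | 0, f => f
  | r + 1, f => Rop (k + 2 * (r : ℤ)) (Riter k r f)

/-- Iterated lowering operator `L_k^r = L_{k−2(r−1)} ∘ ⋯ ∘ L_{k−2} ∘ L_k`, `L_k^0 = id`. -/
noncomputable def Liter (k : ℤ) : ℕ → (ℂ → ℂ) → ℂ → ℂ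
  | 0, f => f
  | r + 1, f => Lop (k - 2 * (r : ℤ)) (Liter k r f)

/-- The flipping operator `𝔉_k f = (v^{−k}/(−k)!) ⋅ conj(R_k^{−k} f)`, for `k ≤ 0`. -/
noncomputable def flipOp (k : ℤ) (f : ℂ → ℂ) (z : ℂ) : ℂ :=
  ((z.im : ℂ) ^ (-k) / ((-k).toNat.factorial : ℂ)) *
    (starRingEnd ℂ) (Riter k (-k).toNat f z)

theorem isOpen_UH : IsOpen UH := isOpen_lt continuous_const Complex.continuous_im

theorem im_ne_zero_of_mem_UH {z : ℂ} (hz : z ∈ UH) : (z.im : ℂ) ≠ 0 :=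
  Complex.ofReal_ne_zero.mpr (ne_of_gt hz)

theorem ContDiffOn.differentiableAt_UH {f : ℂ → ℂ} (hf : ContDiffOn ℝ (⊤ : ℕ∞) f UH) {z : ℂ}
    (hz : z ∈ UH) : DifferentiableAt ℝ f z :=
  (hf.contDiffAt (isOpen_UH.mem_nhds hz)).differentiableAt (by simp)

theorem ContDiffOn.fderiv_apply_UH {f : ℂ → ℂ} (hf : ContDiffOn ℝ (⊤ : ℕ∞) f UH) (e : ℂ) :
    ContDiffOn ℝ (⊤ : ℕ∞) (fun z => fderiv ℝ f z e) UH :=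
  (hf.fderiv_of_isOpen isOpen_UH (by simp)).clm_apply contDiffOn_const

theorem ContDiffOn.dtau {f : ℂ → ℂ} (hf : ContDiffOn ℝ (⊤ : ℕ∞) f UH) :
    ContDiffOn ℝ (⊤ : ℕ∞) (dtau f) UH :=
  contDiffOn_const.mul ((hf.fderiv_apply_UH 1).sub (contDiffOn_const.mul (hf.fderiv_apply_UH I)))

theorem ContDiffOn.dtauBar {f : ℂ → ℂ} (hf : ContDiffOn ℝ (⊤ : ℕ∞) f UH) :
    ContDiffOn ℝ (⊤ : ℕ∞) (dtauBar f) UH :=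
  contDiffOn_const.mul ((hf.fderiv_apply_UH 1).add (contDiffOn_const.mul (hf.fderiv_apply_UH I)))

theorem hasFDerivAt_im_zpow (m : ℤ) {z : ℂ} (hz : z ∈ UH) :
    HasFDerivAt (fun w : ℂ => (w.im : ℂ) ^ m)
      (((m : ℂ) * (z.im : ℂ) ^ (m - 1)) • (Complex.ofRealCLM.comp Complex.imCLM)) z := by
  have h := hasDerivAt_zpow m (z.im : ℂ) (Or.inl (im_ne_zero_of_mem_UH hz))
  exact h.comp_hasFDerivAt z (Complex.ofRealCLM.comp Complex.imCLM).hasFDerivAt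

theorem contDiffOn_im_zpow (m : ℤ) :
    ContDiffOn ℝ (⊤ : ℕ∞) (fun w : ℂ => (w.im : ℂ) ^ m) UH := by
  have h : ContDiff ℝ (⊤ : ℕ∞) (fun w : ℂ => (w.im : ℂ)) :=
    (Complex.ofRealCLM.comp Complex.imCLM).contDiff
  obtain ⟨n, rfl | rfl⟩ := m.eq_nat_or_neg
  · simpa using (h.pow n).contDiffOn
  · simpa [Pi.inv_def] using (h.pow n).contDiffOn.inv fun z hz => pow_ne_zero n (im_ne_zero_of_mem_UH hz)

theorem dtau_im_zpow (m : ℤ) {z : ℂ} (hz : z ∈ UH) :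
    dtau (fun w : ℂ => (w.im : ℂ) ^ m) z = -I / 2 * (m * (z.im : ℂ) ^ (m - 1)) := by
  simp [dtau, du, dv, (hasFDerivAt_im_zpow m hz).fderiv]
  ring

theorem dtauBar_im_zpow (m : ℤ) {z : ℂ} (hz : z ∈ UH) :
    dtauBar (fun w : ℂ => (w.im : ℂ) ^ m) z = I / 2 * (m * (z.im : ℂ) ^ (m - 1)) := by
  simp [dtauBar, du, dv, (hasFDerivAt_im_zpow m hz).fderiv]
  ring

theorem dtau_mul {f g : ℂ → ℂ} {z : ℂ} (hf : DifferentiableAt ℝ f z)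
    (hg : DifferentiableAt ℝ g z) :
    dtau (fun w => f w * g w) z = dtau f z * g z + f z * dtau g z := by
  simp [dtau, du, dv, fderiv_fun_mul hf hg]
  ring

theorem dtauBar_mul {f g : ℂ → ℂ} {z : ℂ} (hf : DifferentiableAt ℝ f z)
    (hg : DifferentiableAt ℝ g z) :
    dtauBar (fun w => f w * g w) z = dtauBar f z * g z + f z * dtauBar g z := by
  simp [dtauBar, du, dv, fderiv_fun_mul hf hg]
  ring

theorem dtau_const_mul (c : ℂ) {f : ℂ → ℂ} {z : ℂ} (hf : DifferentiableAt ℝ f z) :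
    dtau (fun w => c * f w) z = c * dtau f z := by
  simp [dtau, du, dv, fderiv_const_mul hf]
  ring

theorem dtauBar_const_mul (c : ℂ) {f : ℂ → ℂ} {z : ℂ} (hf : DifferentiableAt ℝ f z) :
    dtauBar (fun w => c * f w) z = c * dtauBar f z := by
  simp [dtauBar, du, dv, fderiv_const_mul hf]
  ring

theorem dtauBar_add {f g : ℂ → ℂ} {z : ℂ} (hf : DifferentiableAt ℝ f z)
    (hg : DifferentiableAt ℝ g z) :
    dtauBar (fun w => f w + g w) z = dtauBar f z + dtauBar g z := by
  simp [dtauBar, du, dv, fderiv_fun_add hf hg]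
  ring

theorem dtau_conj {f : ℂ → ℂ} {z : ℂ} (hf : DifferentiableAt ℝ f z) :
    dtau (fun w => (starRingEnd ℂ) (f w)) z = (starRingEnd ℂ) (dtauBar f z) := by
  have h : HasFDerivAt (fun w => (starRingEnd ℂ) (f w))
      ((Complex.conjCLE : ℂ →L[ℝ] ℂ).comp (fderiv ℝ f z)) z :=
    (Complex.conjCLE : ℂ →L[ℝ] ℂ).hasFDerivAt.comp z hf.hasFDerivAt
  simp [dtau, dtauBar, du, dv, h.fderiv, Complex.conj_ofNat]
  ring

theorem dv_du_eq_du_dv {f : ℂ → ℂ} (hf : ContDiffOn ℝ (⊤ : ℕ∞) f UH) {z : ℂ} (hz : z ∈ UH) :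
    dv (du f) z = du (dv f) z := by
  have hd : DifferentiableAt ℝ (fderiv ℝ f) z :=
    ((hf.fderiv_of_isOpen (m := (⊤ : ℕ∞)) isOpen_UH (by simp)).contDiffAt
      (isOpen_UH.mem_nhds hz)).differentiableAt (by simp)
  have hs : IsSymmSndFDerivAt ℝ f z :=
    (hf.contDiffAt (isOpen_UH.mem_nhds hz)).isSymmSndFDerivAt
      (by simpa using WithTop.coe_le_coe.2 (le_top : (2 : ℕ∞) ≤ ⊤))
  have key (e e' : ℂ) :
      fderiv ℝ (fun w => fderiv ℝ f w e) z e' = fderiv ℝ (fderiv ℝ f) z e' e := by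
    simp [fderiv_clm_apply hd (differentiableAt_const e)]
  change fderiv ℝ (fun w => fderiv ℝ f w 1) z I = fderiv ℝ (fun w => fderiv ℝ f w I) z 1
  rw [key, key, hs.eq]

theorem dtauBar_dtau {f : ℂ → ℂ} (hf : ContDiffOn ℝ (⊤ : ℕ∞) f UH) {z : ℂ} (hz : z ∈ UH) :
    dtauBar (dtau f) z = 1 / 4 * (du (du f) z + dv (dv f) z) := by
  have hu : DifferentiableAt ℝ (du f) z := (hf.fderiv_apply_UH 1).differentiableAt_UH hz
  have hv : DifferentiableAt ℝ (dv f) z := (hf.fderiv_apply_UH I).differentiableAt_UH hz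
  have key (e : ℂ) : fderiv ℝ (dtau f) z e
      = 1 / 2 * (fderiv ℝ (du f) z e - I * fderiv ℝ (dv f) z e) := by
    have h := (hu.hasFDerivAt.sub (hv.hasFDerivAt.const_mul I)).const_mul (1 / 2 : ℂ)
    have h' : HasFDerivAt (dtau f) _ z := h
    simp [h'.fderiv]
  have hs : fderiv ℝ (du f) z I = fderiv ℝ (dv f) z 1 := dv_du_eq_du_dv hf hz
  unfold dtauBar
  simp only [du.eq_1 (dtau f), dv.eq_1 (dtau f), key, du.eq_1 (du f), dv.eq_1 (dv f), hs]
  linear_combination (-1 / 4 * fderiv ℝ (dv f) z I) * I_sq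

theorem dtau_dtauBar {f : ℂ → ℂ} (hf : ContDiffOn ℝ (⊤ : ℕ∞) f UH) {z : ℂ} (hz : z ∈ UH) :
    dtau (dtauBar f) z = 1 / 4 * (du (du f) z + dv (dv f) z) := by
  have hu : DifferentiableAt ℝ (du f) z := (hf.fderiv_apply_UH 1).differentiableAt_UH hz
  have hv : DifferentiableAt ℝ (dv f) z := (hf.fderiv_apply_UH I).differentiableAt_UH hz
  have key (e : ℂ) : fderiv ℝ (dtauBar f) z e
      = 1 / 2 * (fderiv ℝ (du f) z e + I * fderiv ℝ (dv f) z e) := by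
    have h := (hu.hasFDerivAt.add (hv.hasFDerivAt.const_mul I)).const_mul (1 / 2 : ℂ)
    have h' : HasFDerivAt (dtauBar f) _ z := h
    simp [h'.fderiv, mul_add]
  have hs : fderiv ℝ (du f) z I = fderiv ℝ (dv f) z 1 := dv_du_eq_du_dv hf hz
  unfold dtau
  simp only [du.eq_1 (dtauBar f), dv.eq_1 (dtauBar f), key, du.eq_1 (du f), dv.eq_1 (dv f), hs]
  linear_combination (-1 / 4 * fderiv ℝ (dv f) z I) * I_sq

theorem Rop_eq (k : ℤ) (f : ℂ → ℂ) :
    Rop k f = fun z => 2 * I * dtau f z + k * ((z.im : ℂ) ^ (-1 : ℤ) * f z) := by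
  ext z
  simp only [Rop, zpow_neg_one]
  ring

theorem Lop_eq (k : ℤ) (f : ℂ → ℂ) :
    Lop k f = fun z => -2 * I * ((z.im : ℂ) ^ (2 : ℤ) * dtauBar f z) := by
  ext z
  simp only [Lop, mul_assoc]
  norm_cast

theorem ContDiffOn.Rop {f : ℂ → ℂ} (hf : ContDiffOn ℝ (⊤ : ℕ∞) f UH) (k : ℤ) :
    ContDiffOn ℝ (⊤ : ℕ∞) (Rop k f) UH := by
  rw [Rop_eq]
  exact (contDiffOn_const.mul hf.dtau).add
    (contDiffOn_const.mul ((contDiffOn_im_zpow (-1)).mul hf))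

theorem ContDiffOn.Lop {f : ℂ → ℂ} (hf : ContDiffOn ℝ (⊤ : ℕ∞) f UH) (k : ℤ) :
    ContDiffOn ℝ (⊤ : ℕ∞) (Lop k f) UH := by
  rw [Lop_eq]
  exact contDiffOn_const.mul ((contDiffOn_im_zpow 2).mul hf.dtauBar)

theorem ContDiffOn.Riter {f : ℂ → ℂ} (hf : ContDiffOn ℝ (⊤ : ℕ∞) f UH) (k : ℤ) (r : ℕ) :
    ContDiffOn ℝ (⊤ : ℕ∞) (Riter k r f) UH := by
  induction r with
  | zero => exact hf
  | succ r ih => exact ih.Rop _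

theorem ContDiffOn.Liter {f : ℂ → ℂ} (hf : ContDiffOn ℝ (⊤ : ℕ∞) f UH) (k : ℤ) (r : ℕ) :
    ContDiffOn ℝ (⊤ : ℕ∞) (Liter k r f) UH := by
  induction r with
  | zero => exact hf
  | succ r ih => exact ih.Lop _

theorem fderiv_congr_UH {f g : ℂ → ℂ} (h : Set.EqOn f g UH) {z : ℂ} (hz : z ∈ UH) :
    fderiv ℝ f z = fderiv ℝ g z :=
  (h.eventuallyEq_of_mem (isOpen_UH.mem_nhds hz)).fderiv_eq

theorem Rop_congr (k : ℤ) {f g : ℂ → ℂ} (h : Set.EqOn f g UH) :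
    Set.EqOn (Rop k f) (Rop k g) UH := fun z hz => by
  simp only [Rop, dtau, du, dv, fderiv_congr_UH h hz, h hz]

theorem Lop_congr (k : ℤ) {f g : ℂ → ℂ} (h : Set.EqOn f g UH) :
    Set.EqOn (Lop k f) (Lop k g) UH := fun z hz => by
  simp only [Lop, dtauBar, du, dv, fderiv_congr_UH h hz]

theorem Liter_congr (k : ℤ) (r : ℕ) {f g : ℂ → ℂ} (h : Set.EqOn f g UH) :
    Set.EqOn (Liter k r f) (Liter k r g) UH := by
  induction r with
  | zero => exact h
  | succ r ih => exact Lop_congr _ ih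

theorem Rop_const_mul (k : ℤ) (c : ℂ) {f : ℂ → ℂ} (hf : ContDiffOn ℝ (⊤ : ℕ∞) f UH) :
    Set.EqOn (Rop k fun w => c * f w) (fun w => c * Rop k f w) UH := fun z hz => by
  simp only [Rop, dtau_const_mul c (hf.differentiableAt_UH hz)]
  ring

theorem Lop_const_mul (k : ℤ) (c : ℂ) {f : ℂ → ℂ} (hf : ContDiffOn ℝ (⊤ : ℕ∞) f UH) :
    Set.EqOn (Lop k fun w => c * f w) (fun w => c * Lop k f w) UH := fun z hz => by
  simp only [Lop, dtauBar_const_mul c (hf.differentiableAt_UH hz)]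
  ring

theorem Liter_const_mul (k : ℤ) (r : ℕ) (c : ℂ) {f : ℂ → ℂ}
    (hf : ContDiffOn ℝ (⊤ : ℕ∞) f UH) :
    Set.EqOn (Liter k r fun w => c * f w) (fun w => c * Liter k r f w) UH := by
  induction r with
  | zero => exact fun z _ => rfl
  | succ r ih => exact (Lop_congr _ ih).trans (Lop_const_mul _ c (hf.Liter k r))

theorem Liter_succ' (k : ℤ) (r : ℕ) (f : ℂ → ℂ) :
    Liter k (r + 1) f = Liter k r (Lop k f) := by
  induction r with
  | zero => rfl
  | succ r ih => exact congrArg (Lop k) ih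

/-- `L_{k+2} R_k = -Δ_k - k`. -/
theorem Lop_Rop (k m : ℤ) {f : ℂ → ℂ} (hf : ContDiffOn ℝ (⊤ : ℕ∞) f UH) {z : ℂ} (hz : z ∈ UH) :
    Lop m (Rop k f) z = -Lap k f z - k * f z := by
  have hd := hf.differentiableAt_UH hz
  have hv := (contDiffOn_im_zpow (-1)).differentiableAt_UH hz
  have hvf := ((contDiffOn_im_zpow (-1)).mul hf).differentiableAt_UH hz
  have hτ := hf.dtau.differentiableAt_UH hz
  have h0 := im_ne_zero_of_mem_UH hz
  have hB : dtauBar (Rop k f) z = 2 * I * dtauBar (dtau f) z + k * (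
      I / 2 * (((-1 : ℤ) : ℂ) * (z.im : ℂ) ^ (-1 - 1 : ℤ)) * f z
        + (z.im : ℂ) ^ (-1 : ℤ) * dtauBar f z) := by
    rw [Rop_eq, dtauBar_add (hτ.const_mul _) (hvf.const_mul _), dtauBar_const_mul _ hτ,
      dtauBar_const_mul _ hvf, dtauBar_mul hv hd, dtauBar_im_zpow _ hz]
  rw [Lop, hB, dtauBar_dtau hf hz, Lap, dtauBar]
  have e : (z.im : ℂ) ^ (-1 - 1 : ℤ) = ((z.im : ℂ) ^ 2)⁻¹ := by
    norm_num [zpow_neg]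
  rw [e, zpow_neg_one]
  field_simp
  push_cast
  linear_combination 4 * (-(z.im : ℂ) ^ 2 * (du (du f) z + dv (dv f) z) + k * f z) * I_sq

/-- `R_{k-2} L_k = -Δ_k`. -/
theorem Rop_Lop (k : ℤ) {f : ℂ → ℂ} (hf : ContDiffOn ℝ (⊤ : ℕ∞) f UH) {z : ℂ} (hz : z ∈ UH) :
    Rop (k - 2) (Lop k f) z = -Lap k f z := by
  have hv := (contDiffOn_im_zpow 2).differentiableAt_UH hz
  have hτ := hf.dtauBar.differentiableAt_UH hz
  have h0 := im_ne_zero_of_mem_UH hz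
  have hB : dtau (Lop k f) z = -2 * I * (
      -I / 2 * (((2 : ℤ) : ℂ) * (z.im : ℂ) ^ (2 - 1 : ℤ)) * dtauBar f z
        + (z.im : ℂ) ^ (2 : ℤ) * dtau (dtauBar f) z) := by
    rw [Lop_eq, dtau_const_mul _ (hv.fun_mul hτ), dtau_mul hv hτ, dtau_im_zpow _ hz]
  rw [Rop, hB, dtau_dtauBar hf hz, Lap, Lop, dtauBar]
  have e : (z.im : ℂ) ^ (2 - 1 : ℤ) = z.im := by norm_num
  have e' : (z.im : ℂ) ^ (2 : ℤ) = (z.im : ℂ) ^ 2 := by norm_cast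
  rw [e, e']
  field_simp
  push_cast
  linear_combination 4 * (2 * I * (du f z + I * dv f z)
    - (z.im : ℂ) * (du (du f) z + dv (dv f) z)) * I_sq

theorem Lop_Riter_succ (n : ℕ) (m : ℤ) {f : ℂ → ℂ} (hf : ContDiffOn ℝ (⊤ : ℕ∞) f UH)
    (hharm : ∀ z ∈ UH, Lap (-n) f z = 0) (r : ℕ) :
    Set.EqOn (Lop m (Riter (-n) (r + 1) f))
      (fun z => ((r + 1) * (n - r) : ℂ) * Riter (-n) r f z) UH := by
  induction r generalizing m with
  | zero =>
    intro z hz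
    simp [Riter, Lop_Rop _ m hf hz, hharm z hz]
  | succ r ih =>
    intro z hz
    have hg := hf.Riter (-n) (r + 1)
    have h1 := Lop_Rop (-n + 2 * ((r + 1 : ℕ) : ℤ)) m hg hz
    have h2 := Rop_Lop (-n + 2 * ((r + 1 : ℕ) : ℤ)) hg hz
    rw [Rop_congr _ (ih _) hz, Rop_const_mul _ _ (hf.Riter (-n) r) hz] at h2
    have h3 : (-n + 2 * ((r + 1 : ℕ) : ℤ) - 2 : ℤ) = -n + 2 * r := by push_cast; ring
    rw [h3] at h2
    change Lop m (Rop (-n + 2 * ((r + 1 : ℕ) : ℤ)) (Riter (-n) (r + 1) f)) z = _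
    rw [h1, ← h2]
    change _ * Riter (-n) (r + 1) f z - _ = _
    push_cast
    ring

theorem Liter_Riter (n : ℕ) (m : ℤ) {f : ℂ → ℂ} (hf : ContDiffOn ℝ (⊤ : ℕ∞) f UH)
    (hharm : ∀ z ∈ UH, Lap (-n) f z = 0) {r : ℕ} (hr : r ≤ n) :
    Set.EqOn (Liter m r (Riter (-n) r f))
      (fun z => (r.factorial * n.descFactorial r : ℂ) * f z) UH := by
  induction r with
  | zero => intro z _; simp [Liter, Riter]
  | succ r ih =>
    intro z hz
    rw [Liter_succ', Liter_congr m r (Lop_Riter_succ n m hf hharm r) hz,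
      Liter_const_mul m r _ (hf.Riter _ r) hz]
    beta_reduce
    rw [ih (by omega) hz, Nat.factorial_succ,
      Nat.descFactorial_succ]
    push_cast [Nat.cast_sub (show r ≤ n by omega)]
    ring

/-- `R_k (v^{-k} conj f) = v^{-k-2} conj (L f)`. -/
theorem Rop_im_zpow_mul_conj (k m : ℤ) {f : ℂ → ℂ} (hf : ContDiffOn ℝ (⊤ : ℕ∞) f UH) :
    Set.EqOn (Rop k fun w => (w.im : ℂ) ^ (-k) * (starRingEnd ℂ) (f w))
      (fun w => (w.im : ℂ) ^ (-(k + 2)) * (starRingEnd ℂ) (Lop m f w)) UH := by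
  intro z hz
  have hd := hf.differentiableAt_UH hz
  have hc : DifferentiableAt ℝ (fun w => (starRingEnd ℂ) (f w)) z :=
    (Complex.conjCLE : ℂ →L[ℝ] ℂ).differentiableAt.comp z hd
  have hv := (contDiffOn_im_zpow (-k)).differentiableAt_UH hz
  have h0 := im_ne_zero_of_mem_UH hz
  rw [Rop, dtau_mul hv hc, dtau_im_zpow _ hz, dtau_conj hd]
  have e1 : (z.im : ℂ) ^ (-k - 1) = (z.im : ℂ) ^ (-k) * (z.im : ℂ)⁻¹ := by
    rw [zpow_sub_one₀ h0]
  have e2 : (z.im : ℂ) ^ (-k) = (z.im : ℂ) ^ (-(k + 2)) * (z.im : ℂ) ^ 2 := by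
    rw [← zpow_natCast, ← zpow_add₀ h0]
    congr 1
    push_cast
    ring
  rw [e1, e2]
  simp only [Lop, map_mul, map_neg, map_pow, conj_I, conj_ofReal, map_ofNat]
  field_simp
  push_cast
  linear_combination (k * (starRingEnd ℂ) (f z)) * I_sq

theorem Riter_im_zpow_mul_conj (k m : ℤ) {f : ℂ → ℂ} (hf : ContDiffOn ℝ (⊤ : ℕ∞) f UH) (r : ℕ) :
    Set.EqOn (Riter k r fun w => (w.im : ℂ) ^ (-k) * (starRingEnd ℂ) (f w))
      (fun w => (w.im : ℂ) ^ (-(k + 2 * (r : ℤ))) * (starRingEnd ℂ) (Liter m r f w)) UH := by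
  induction r with
  | zero => intro z _; simp [Riter, Liter]
  | succ r ih =>
    have h := (Rop_congr (k + 2 * r) ih).trans
      (Rop_im_zpow_mul_conj (k + 2 * r) (m - 2 * r) (hf.Liter m r))
    have e : k + 2 * ((r + 1 : ℕ) : ℤ) = k + 2 * r + 2 := by push_cast; ring
    rw [e]
    exact h

/-- if `k ≤ 0` and `Δ_k f = 0` then `𝔉_k(𝔉_k f) = f`. -/
theorem stmt9 (k : ℤ) (hk : k ≤ 0) (f : ℂ → ℂ) (hf : ContDiffOn ℝ (⊤ : ℕ∞) f UH)
    (hharm : ∀ z ∈ UH, Lap k f z = 0) :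
    ∀ z ∈ UH, flipOp k (flipOp k f) z = f z := by
  intro z hz
  obtain ⟨n, rfl⟩ : ∃ n : ℕ, k = -n := ⟨(-k).toNat, by omega⟩
  have h0 := im_ne_zero_of_mem_UH hz
  have hn : (n.factorial : ℂ) ≠ 0 := Nat.cast_ne_zero.mpr n.factorial_ne_zero
  have hg := hf.Riter (-n) n
  have hflip : flipOp (-n) f = fun w => (w.im : ℂ) ^ (-(-n : ℤ)) *
      (starRingEnd ℂ) ((n.factorial : ℂ)⁻¹ * Riter (-n) n f w) := by
    ext w
    simp only [flipOp, neg_neg, Int.toNat_natCast, map_mul, map_inv₀, map_natCast]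
    ring
  rw [flipOp, neg_neg, Int.toNat_natCast, hflip,
    Riter_im_zpow_mul_conj (-n) 0 (contDiffOn_const.mul hg) n hz]
  beta_reduce
  rw [Liter_const_mul 0 n _ hg hz]
  beta_reduce
  rw [Liter_Riter n 0 hf hharm le_rfl hz, Nat.descFactorial_self]
  have e : -(-(n : ℤ) + 2 * n) = -n := by ring
  simp only [e, map_mul, map_inv₀, map_pow, conj_ofReal, conj_conj, zpow_neg, zpow_natCast]
  field_simp
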